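/- Let T_n denote the number of spanning trees of the 2×n grid graph G_2(n), and let F_n denote the number of spanning forests of G_2(n) that have exactly two connected components such that the two rightmost vertices v_{1,n} and v_{2,n} lie in distinct components. Then for every n ≥ 2, T_n = 3·T_{n-1} + F_{n-1} and F_n = 2·T_{n-1} + F_{n-1}. -/

import Mathlib

open SimpleGraph

/-- The number of spanning trees of a simple graph `G`. -/
noncomputable def spanningTreeCount {V : Type*} (G : SimpleGraph V) : ℕ :=
  Nat.card {H : G.Subgraph // H.IsSpanning ∧ H.coe.IsTree}

/-- The number of spanning trees of the `k × n` grid graph `G_k(n) = P_k □ P_n`. -/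
noncomputable def gridTreeCount (k n : ℕ) : ℕ :=
  spanningTreeCount (pathGraph k □ pathGraph n)

/-- The number of spanning forests of the `2 × n` grid graph having exactly two connected
components such that the two rightmost vertices `v_{1,n}` and `v_{2,n}` lie in distinct
components. -/
noncomputable def gridForestCount : ℕ → ℕ
  | 0 => 0
  | (n + 1) =>
    Nat.card {H : (pathGraph 2 □ pathGraph (n + 1)).Subgraph //
      H.IsSpanning ∧ H.spanningCoe.IsAcyclic ∧
      Nat.card H.spanningCoe.ConnectedComponent = 2 ∧
      ¬ H.spanningCoe.Reachable (0, Fin.last n) (1, Fin.last n)}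

section Connectivity

variable {V W : Type*}

theorem SimpleGraph.Reachable.of_forall_adj {G : SimpleGraph W} {K : SimpleGraph V} (φ : W → V)
    (h : ∀ u v, G.Adj u v → K.Reachable (φ u) (φ v)) {u v : W} (huv : G.Reachable u v) :
    K.Reachable (φ u) (φ v) := by
  obtain ⟨p⟩ := huv
  induction p with
  | nil => exact Reachable.refl _
  | cons hadj _ ih => exact (h _ _ hadj).trans ih

theorem SimpleGraph.Connected.of_surjective {G : SimpleGraph W} {K : SimpleGraph V} (φ : W → V)
    (hφ : Function.Surjective φ) (h : ∀ u v, G.Adj u v → K.Reachable (φ u) (φ v))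
    (hG : G.Connected) : K.Connected := by
  have := hG.nonempty.map φ
  refine ⟨fun x y => ?_⟩
  obtain ⟨u, rfl⟩ := hφ x
  obtain ⟨v, rfl⟩ := hφ y
  exact (hG u v).of_forall_adj φ h

theorem SimpleGraph.Connected.of_forall_reachable_map {G : SimpleGraph W} {K : SimpleGraph V}
    (f : V → W) (h : ∀ u v, K.Adj u v → G.Reachable (f u) (f v))
    (hf : ∀ w, ∃ v, G.Reachable w (f v)) (hK : K.Connected) : G.Connected := by
  have := hK.nonempty.map f
  refine ⟨fun x y => ?_⟩
  obtain ⟨u, hu⟩ := hf x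
  obtain ⟨v, hv⟩ := hf y
  exact hu.trans (((hK u v).of_forall_adj f h).trans hv.symm)

theorem SimpleGraph.not_connected_of_forall_not_adj [Nontrivial V] {G : SimpleGraph V} (v : V)
    (h : ∀ w, ¬ G.Adj v w) : ¬ G.Connected := fun hG =>
  let ⟨w, hw⟩ := hG.preconnected.exists_adj_of_nontrivial v
  h w hw

theorem SimpleGraph.natCard_edgeSet_sup_edge [Finite V] {G : SimpleGraph V} {a b : V}
    (hab : a ≠ b) (h : ¬ G.Adj a b) :
    Nat.card (G ⊔ edge a b).edgeSet = Nat.card G.edgeSet + 1 := by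
  classical
  have := Fintype.ofFinite V
  rw [Nat.card_eq_fintype_card, Nat.card_eq_fintype_card, ← edgeFinset_card, ← edgeFinset_card]
  exact G.card_edgeFinset_sup_edge h hab

theorem SimpleGraph.natCard_edgeSet_map (f : V ↪ W) (G : SimpleGraph V) :
    Nat.card (G.map f).edgeSet = Nat.card G.edgeSet := by
  rw [edgeSet_map]
  exact Nat.card_image_of_injective f.sym2Map.injective _

/-- A forest with two components separating `a` from `b` is a tree containing the edge `ab`,
with that edge removed. -/
theorem SimpleGraph.isAcyclic_and_card_eq_two_and_not_reachable_iff {H : SimpleGraph V} {a b : V}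
    (hab : a ≠ b) :
    (H.IsAcyclic ∧ Nat.card H.ConnectedComponent = 2 ∧ ¬ H.Reachable a b) ↔
      ¬ H.Adj a b ∧ (H ⊔ edge a b).IsTree := by
  have hadj : (H ⊔ edge a b).Adj a b := by simp [edge_adj, hab]
  constructor
  · rintro ⟨hac, hcard, hr⟩
    refine ⟨fun h => hr h.reachable, ?_, hac.sup_edge_of_not_reachable hr⟩
    have key : ∀ v, (H ⊔ edge a b).Reachable a v := by
      intro v
      have hne : H.connectedComponentMk a ≠ H.connectedComponentMk b := by
        simpa [ConnectedComponent.eq] using hr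
      have := ((Nat.card_eq_two_iff' (H.connectedComponentMk a)).1 hcard).unique
        (y₁ := H.connectedComponentMk b) (y₂ := H.connectedComponentMk v) hne.symm
      by_cases hv : H.Reachable a v
      · exact hv.mono le_sup_left
      · have h2 := this (fun h => hv (ConnectedComponent.eq.1 h).symm)
        exact hadj.reachable.trans ((ConnectedComponent.eq.1 h2).mono le_sup_left)
    exact connected_iff_exists_forall_reachable _ |>.2 ⟨a, key⟩
  · rintro ⟨hn, hT⟩
    have hr : ¬ H.Reachable a b := fun h =>
      ((isAcyclic_sup_fromEdgeSet_iff.1 hT.isAcyclic).2 h).elim hab hn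
    refine ⟨hT.isAcyclic.anti le_sup_left, ?_, hr⟩
    have step : ∀ u v, (H ⊔ edge a b).Walk u v →
        H.Reachable a u ∨ H.Reachable b u → H.Reachable a v ∨ H.Reachable b v := by
      intro u v p
      induction p with
      | nil => exact id
      | cons h _ ih =>
        refine fun hu => ih ?_
        rcases h with h | h
        · exact hu.imp (·.trans h.reachable) (·.trans h.reachable)
        · rcases ((edge_adj ..).1 h).1 with ⟨-, rfl⟩ | ⟨-, rfl⟩
          · exact Or.inr (Reachable.refl _)
          · exact Or.inl (Reachable.refl _)
    have key : ∀ v, H.Reachable a v ∨ H.Reachable b v := fun v =>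
      let ⟨p⟩ := hT.connected a v
      step a v p (Or.inl (Reachable.refl _))
    rw [Nat.card_eq_two_iff]
    refine ⟨H.connectedComponentMk a, H.connectedComponentMk b, ?_, ?_⟩
    · simpa [ConnectedComponent.eq] using hr
    · refine Set.eq_univ_of_forall fun c => ?_
      induction c using ConnectedComponent.ind with | _ v
      rcases key v with h | h
      · exact Or.inl (ConnectedComponent.eq.2 h.symm)
      · exact Or.inr (ConnectedComponent.eq.2 h.symm)

/-- Spanning subgraphs of `G` correspond to graphs below `G`. -/
def SimpleGraph.spanningSubgraphEquiv (G : SimpleGraph V) :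
    {H : G.Subgraph // H.IsSpanning} ≃ {H : SimpleGraph V // H ≤ G} where
  toFun H := ⟨H.1.spanningCoe, H.1.spanningCoe_le⟩
  invFun H := ⟨toSubgraph H.1 H.2, toSubgraph.isSpanning _ _⟩
  left_inv H := by
    apply Subtype.ext
    apply Subgraph.ext
    · exact (Subgraph.isSpanning_iff.1 H.2).symm
    · rfl
  right_inv H := rfl

theorem SimpleGraph.natCard_spanning_subgraph (G : SimpleGraph V) (P : SimpleGraph V → Prop) :
    Nat.card {H : G.Subgraph // H.IsSpanning ∧ P H.spanningCoe} =
      Nat.card {H : {H : SimpleGraph V // H ≤ G} // P H.1} :=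
  Nat.card_congr ((Equiv.subtypeSubtypeEquivSubtypeInter _ _).symm.trans
    (G.spanningSubgraphEquiv.subtypeEquiv fun _ => Iff.rfl))

end Connectivity

theorem spanningTreeCount_eq {V : Type*} (G : SimpleGraph V) :
    spanningTreeCount G = Nat.card {H : {H : SimpleGraph V // H ≤ G} // H.1.IsTree} := by
  rw [← natCard_spanning_subgraph]
  exact Nat.card_congr (Equiv.subtypeEquivRight fun H => and_congr_right fun h =>
    (H.spanningCoeEquivCoeOfSpanning h).isTree_iff.symm)

/-- An embedding of `V` into a type `W` with exactly two further points, `c` and `d`, together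
with two points `a` and `b` of `V` to which these are to be attached. -/
structure RungExtension (V W : Type*) extends V ↪ W where
  (a b : V) (c d : W)
  hab : a ≠ b
  hcd : c ≠ d
  hc : ∀ v, toFun v ≠ c
  hd : ∀ v, toFun v ≠ d
  exhaust : ∀ w, (∃ v, w = toFun v) ∨ w = c ∨ w = d

namespace RungExtension

variable {V W : Type*} (E : RungExtension V W)

/-- The graph on `W` consisting of a copy of `H` and those of the edges `ac`, `bd`, `cd` selected by
`s`, `t`, `r`. -/
def extend (H : SimpleGraph V) (s t r : Bool) : SimpleGraph W :=
  H.map E.toEmbedding ⊔ (if s then edge (E.toEmbedding E.a) E.c else ⊥) ⊔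
    (if t then edge (E.toEmbedding E.b) E.d else ⊥) ⊔ (if r then edge E.c E.d else ⊥)

@[simp] theorem emb_ne_c (v : V) : E.toEmbedding v ≠ E.c := E.hc v
@[simp] theorem emb_ne_d (v : V) : E.toEmbedding v ≠ E.d := E.hd v
@[simp] theorem c_ne_emb (v : V) : E.c ≠ E.toEmbedding v := (E.hc v).symm
@[simp] theorem d_ne_emb (v : V) : E.d ≠ E.toEmbedding v := (E.hd v).symm
@[simp] theorem c_ne_d : E.c ≠ E.d := E.hcd
@[simp] theorem d_ne_c : E.d ≠ E.c := E.hcd.symm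
@[simp] theorem a_ne_b : E.a ≠ E.b := E.hab
@[simp] theorem b_ne_a : E.b ≠ E.a := E.hab.symm

theorem eq_emb_or (w : W) : (∃ v, w = E.toEmbedding v) ∨ w = E.c ∨ w = E.d := E.exhaust w

variable (H : SimpleGraph V) (s t r : Bool) (u v : V)

@[simp] theorem extend_adj_emb :
    (E.extend H s t r).Adj (E.toEmbedding u) (E.toEmbedding v) ↔ H.Adj u v := by
  cases s <;> cases t <;> cases r <;> simp [extend, edge_adj]

@[simp] theorem extend_adj_emb_c :
    (E.extend H s t r).Adj (E.toEmbedding u) E.c ↔ s = true ∧ u = E.a := by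
  cases s <;> cases t <;> cases r <;> simp [extend, edge_adj]

@[simp] theorem extend_adj_emb_d :
    (E.extend H s t r).Adj (E.toEmbedding u) E.d ↔ t = true ∧ u = E.b := by
  cases s <;> cases t <;> cases r <;> simp [extend, edge_adj]

@[simp] theorem extend_adj_c_d : (E.extend H s t r).Adj E.c E.d ↔ r = true := by
  cases s <;> cases t <;> cases r <;> simp [extend, edge_adj]

@[simp] theorem extend_adj_c_emb :
    (E.extend H s t r).Adj E.c (E.toEmbedding u) ↔ s = true ∧ u = E.a := by
  rw [adj_comm, extend_adj_emb_c]

@[simp] theorem extend_adj_d_emb :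
    (E.extend H s t r).Adj E.d (E.toEmbedding u) ↔ t = true ∧ u = E.b := by
  rw [adj_comm, extend_adj_emb_d]

@[simp] theorem extend_adj_d_c : (E.extend H s t r).Adj E.d E.c ↔ r = true := by
  rw [adj_comm, extend_adj_c_d]

theorem extend_sup_edge : E.extend H s t r ⊔ edge E.c E.d = E.extend H s t true := by
  cases r <;> simp [extend, sup_assoc]

/-- Graphs below the full extension of `G` are extensions of graphs below `G`. -/
noncomputable def extendEquiv (G : SimpleGraph V) :
    {H : SimpleGraph V // H ≤ G} × Bool × Bool × Bool ≃
      {H : SimpleGraph W // H ≤ E.extend G true true true} :=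
  Equiv.ofBijective
    (fun x => ⟨E.extend x.1.1 x.2.1 x.2.2.1 x.2.2.2, by
      intro w w' h
      rcases E.eq_emb_or w with ⟨v, rfl⟩ | rfl | rfl <;>
        rcases E.eq_emb_or w' with ⟨v', rfl⟩ | rfl | rfl <;>
        simp_all
      exact x.1.2 h⟩) <| by
    constructor
    · rintro ⟨⟨H, hH⟩, s, t, r⟩ ⟨⟨H', hH'⟩, s', t', r'⟩ h
      have h := Subtype.ext_iff.1 h
      dsimp only at h
      have h1 : H = H' := by
        ext u v
        rw [← E.extend_adj_emb H s t r, h, extend_adj_emb]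
      have h2 : s = s' := by
        rw [Bool.eq_iff_iff]
        simpa using iff_of_eq (congrArg (fun K => K.Adj (E.toEmbedding E.a) E.c) h)
      have h3 : t = t' := by
        rw [Bool.eq_iff_iff]
        simpa using iff_of_eq (congrArg (fun K => K.Adj (E.toEmbedding E.b) E.d) h)
      have h4 : r = r' := by
        rw [Bool.eq_iff_iff]
        simpa using iff_of_eq (congrArg (fun K => K.Adj E.c E.d) h)
      subst h1 h2 h3 h4
      rfl
    · classical
      rintro ⟨K, hK⟩
      refine ⟨⟨⟨K.comap E.toEmbedding, fun u v h => by simpa using hK h⟩,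
        decide (K.Adj (E.toEmbedding E.a) E.c), decide (K.Adj (E.toEmbedding E.b) E.d),
        decide (K.Adj E.c E.d)⟩, ?_⟩
      apply Subtype.ext
      ext w w'
      have hK' := @hK w w'
      rcases E.eq_emb_or w with ⟨v, rfl⟩ | rfl | rfl <;>
        rcases E.eq_emb_or w' with ⟨v', rfl⟩ | rfl | rfl <;>
        simp_all [K.adj_comm] <;> grind [K.adj_comm]

theorem exists_retraction (x y : V) :
    ∃ ρ : W → V, (∀ v, ρ (E.toEmbedding v) = v) ∧ ρ E.c = x ∧ ρ E.d = y := by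
  classical
  refine ⟨Function.extend E.toEmbedding id fun w => if w = E.c then x else y,
    fun v => ?_, ?_, ?_⟩
  · exact E.toEmbedding.injective.extend_apply _ _ v
  · rw [Function.extend_apply' _ _ _ (by simp)]; simp
  · rw [Function.extend_apply' _ _ _ (by simp)]; simp

variable {H s t r}

theorem connected_of_connected_extend (K : SimpleGraph V) (x y : V)
    (hK : H ≤ K) (hs : s = true → K.Reachable E.a x) (ht : t = true → K.Reachable E.b y)
    (hr : r = true → K.Reachable x y) (h : (E.extend H s t r).Connected) : K.Connected := by
  obtain ⟨ρ, h1, h2, h3⟩ := E.exists_retraction x y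
  refine h.of_surjective ρ (fun v => ⟨_, h1 v⟩) fun w w' hw => ?_
  rcases E.eq_emb_or w with ⟨v, rfl⟩ | rfl | rfl <;>
    rcases E.eq_emb_or w' with ⟨v', rfl⟩ | rfl | rfl <;>
    simp only [h1, h2, h3, extend_adj_emb, extend_adj_emb_c, extend_adj_emb_d, extend_adj_c_d,
      extend_adj_c_emb, extend_adj_d_emb, extend_adj_d_c, SimpleGraph.irrefl] at hw ⊢
  · exact (hK hw).reachable
  · exact hw.2 ▸ hs hw.1
  · exact hw.2 ▸ ht hw.1
  · exact hw.2 ▸ (hs hw.1).symm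
  · exact hr hw
  · exact hw.2 ▸ (ht hw.1).symm
  · exact (hr hw).symm

theorem connected_extend (K : SimpleGraph V) (hK : K.Connected)
    (h : ∀ u v, K.Adj u v →
      (E.extend H s t r).Reachable (E.toEmbedding u) (E.toEmbedding v))
    (ha : ∃ v, (E.extend H s t r).Reachable E.c (E.toEmbedding v))
    (hb : ∃ v, (E.extend H s t r).Reachable E.d (E.toEmbedding v)) :
    (E.extend H s t r).Connected := by
  refine hK.of_forall_reachable_map E.toEmbedding h fun w => ?_
  rcases E.eq_emb_or w with ⟨v, rfl⟩ | rfl | rfl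
  exacts [⟨v, Reachable.refl _⟩, ha, hb]

theorem connected_extend_rails_iff : (E.extend H true true false).Connected ↔ H.Connected := by
  refine ⟨E.connected_of_connected_extend H E.a E.b le_rfl (fun _ => Reachable.refl _)
    (fun _ => Reachable.refl _) (by simp), fun h => E.connected_extend H h
    (fun u v huv => Adj.reachable (by simpa)) ⟨E.a, Adj.reachable (by simp)⟩
    ⟨E.b, Adj.reachable (by simp)⟩⟩

theorem connected_extend_left_rung_iff :
    (E.extend H true false true).Connected ↔ H.Connected := by
  have h1 : (E.extend H true false true).Reachable E.c (E.toEmbedding E.a) :=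
    Adj.reachable (by simp)
  have h2 : (E.extend H true false true).Reachable E.d E.c := Adj.reachable (by simp)
  exact ⟨E.connected_of_connected_extend H E.a E.a le_rfl (fun _ => Reachable.refl _)
    (by simp) (fun _ => Reachable.refl _), fun h => E.connected_extend H h
    (fun u v huv => Adj.reachable (by simpa)) ⟨_, h1⟩ ⟨_, h2.trans h1⟩⟩

theorem connected_extend_right_rung_iff :
    (E.extend H false true true).Connected ↔ H.Connected := by
  have h1 : (E.extend H false true true).Reachable E.d (E.toEmbedding E.b) :=
    Adj.reachable (by simp)
  have h2 : (E.extend H false true true).Reachable E.c E.d := Adj.reachable (by simp)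
  exact ⟨E.connected_of_connected_extend H E.b E.b le_rfl (by simp)
    (fun _ => Reachable.refl _) (fun _ => Reachable.refl _), fun h => E.connected_extend H h
    (fun u v huv => Adj.reachable (by simpa)) ⟨_, h2.trans h1⟩ ⟨_, h1⟩⟩

theorem connected_extend_full_iff :
    (E.extend H true true true).Connected ↔ (H ⊔ edge E.a E.b).Connected := by
  have h1 : (E.extend H true true true).Reachable E.c (E.toEmbedding E.a) :=
    Adj.reachable (by simp)
  have h2 : (E.extend H true true true).Reachable E.d (E.toEmbedding E.b) :=
    Adj.reachable (by simp)
  have h3 : (E.extend H true true true).Reachable E.c E.d := Adj.reachable (by simp)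
  have h4 := h1.symm.trans (h3.trans h2)
  refine ⟨E.connected_of_connected_extend _ E.a E.b le_sup_left (fun _ => Reachable.refl _)
    (fun _ => Reachable.refl _) (fun _ => Adj.reachable (by simp [edge_adj])),
    fun h => E.connected_extend _ h (fun u v huv => ?_) ⟨_, h1⟩ ⟨_, h2⟩⟩
  rcases huv with huv | huv
  · exact Adj.reachable (by simpa)
  · rcases ((edge_adj ..).1 huv).1 with ⟨rfl, rfl⟩ | ⟨rfl, rfl⟩
    exacts [h4, h4.symm]

theorem not_connected_extend_of_left (hs : s = false) (hr : r = false) :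
    ¬ (E.extend H s t r).Connected := by
  have : Nontrivial W := ⟨_, _, E.hcd⟩
  refine not_connected_of_forall_not_adj E.c fun w => ?_
  rcases E.eq_emb_or w with ⟨v, rfl⟩ | rfl | rfl <;> simp [hs, hr]

theorem not_connected_extend_of_right (ht : t = false) (hr : r = false) :
    ¬ (E.extend H s t r).Connected := by
  have : Nontrivial W := ⟨_, _, E.hcd⟩
  refine not_connected_of_forall_not_adj E.d fun w => ?_
  rcases E.eq_emb_or w with ⟨v, rfl⟩ | rfl | rfl <;> simp [ht, hr]

theorem not_connected_extend_of_rails (hs : s = false) (ht : t = false) :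
    ¬ (E.extend H s t r).Connected := by
  intro h
  have := (h E.c (E.toEmbedding E.a)).of_forall_adj (K := (⊥ : SimpleGraph Prop))
    (fun w => ∃ v, E.toEmbedding v = w) fun w w' hw => ?_
  · simp at this
  rcases E.eq_emb_or w with ⟨v, rfl⟩ | rfl | rfl <;>
    rcases E.eq_emb_or w' with ⟨v', rfl⟩ | rfl | rfl <;>
    simp_all

theorem natCard_edgeSet_extend [Finite W] (H : SimpleGraph V) (s t r : Bool) :
    Nat.card (E.extend H s t r).edgeSet = Nat.card H.edgeSet + s.toNat + t.toNat + r.toNat := by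
  have h1 : Nat.card (E.extend H s false false).edgeSet = Nat.card H.edgeSet + s.toNat := by
    have h0 : E.extend H false false false = H.map E.toEmbedding := by simp [extend]
    cases s
    · rw [h0, natCard_edgeSet_map]; rfl
    · have : E.extend H true false false =
          E.extend H false false false ⊔ edge (E.toEmbedding E.a) E.c := by simp [extend]
      rw [this, natCard_edgeSet_sup_edge (by simp) (by simp), h0, natCard_edgeSet_map]; rfl
  have h2 : Nat.card (E.extend H s t false).edgeSet = Nat.card H.edgeSet + s.toNat + t.toNat := by
    cases t
    · rw [h1]; rfl
    · have : E.extend H s true false =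
          E.extend H s false false ⊔ edge (E.toEmbedding E.b) E.d := by simp [extend]
      rw [this, natCard_edgeSet_sup_edge (by simp) (by simp), h1]; rfl
  cases r
  · rw [h2]; rfl
  · rw [← E.extend_sup_edge H s t false, natCard_edgeSet_sup_edge (by simp) (by simp), h2]; rfl

theorem natCard_eq [Finite V] (E : RungExtension V W) : Nat.card W = Nat.card V + 2 := by
  have e : V ⊕ Bool ≃ W := Equiv.ofBijective
    (Sum.elim E.toEmbedding fun c => cond c E.c E.d) <| by
      constructor
      · rintro (u | _ | _) (v | _ | _) h <;> simp_all
      · intro w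
        rcases E.eq_emb_or w with ⟨v, rfl⟩ | rfl | rfl
        exacts [⟨Sum.inl v, rfl⟩, ⟨Sum.inr true, rfl⟩, ⟨Sum.inr false, rfl⟩]
  rw [← Nat.card_congr e, Nat.card_sum]
  simp

theorem isTree_extend_iff [Finite V] [Finite W] : (E.extend H s t r).IsTree ↔
    (s && t && !r || s && !t && r || !s && t && r) ∧ H.IsTree ∨
      (s && t && r) ∧ ¬ H.Adj E.a E.b ∧ (H ⊔ edge E.a E.b).IsTree := by
  by_cases hst : s = false ∧ r = false ∨ t = false ∧ r = false ∨ s = false ∧ t = false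
  · refine iff_of_false (fun h => ?_) (by grind)
    rcases hst with ⟨h1, h2⟩ | ⟨h1, h2⟩ | ⟨h1, h2⟩
    exacts [E.not_connected_extend_of_left h1 h2 h.connected,
      E.not_connected_extend_of_right h1 h2 h.connected,
      E.not_connected_extend_of_rails h1 h2 h.connected]
  simp only [isTree_iff_connected_and_card, natCard_edgeSet_extend, E.natCard_eq]
  cases s <;> cases t <;> cases r <;> simp [-Nat.card_coe_set_eq, -edgeSet_sup] at hst ⊢
  · rw [connected_extend_right_rung_iff]; grind [E.natCard_eq]
  · rw [connected_extend_left_rung_iff]; grind [E.natCard_eq]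
  · rw [connected_extend_rails_iff]; grind [E.natCard_eq]
  · rw [connected_extend_full_iff]
    by_cases h : H.Adj E.a E.b
    · refine iff_of_false (fun ⟨hc, hcard⟩ => ?_) (fun h' => h'.1 h)
      have hW := E.natCard_eq
      rw [sup_edge_of_adj _ h] at hc
      have := hc.card_vert_le_card_edgeSet_add_one
      omega
    · rw [natCard_edgeSet_sup_edge E.hab h]
      grind [E.natCard_eq]

theorem not_adj_and_isTree_extend_sup_edge_iff [Finite V] [Finite W] :
    (¬ (E.extend H s t r).Adj E.c E.d ∧ (E.extend H s t r ⊔ edge E.c E.d).IsTree) ↔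
      r = false ∧ (E.extend H s t true).IsTree := by
  simp [extend_sup_edge]

theorem natCard_subtype_le_extend [Finite V] (G : SimpleGraph V) (P : SimpleGraph W → Prop) :
    Nat.card {K : {K : SimpleGraph W // K ≤ E.extend G true true true} // P K.1} =
      ∑ x : Bool × Bool × Bool, Nat.card
        {H : {H : SimpleGraph V // H ≤ G} // P (E.extend H.1 x.1 x.2.1 x.2.2)} := by
  rw [← Nat.card_sigma]
  refine Nat.card_congr (((E.extendEquiv G).subtypeEquiv fun x => Iff.rfl).symm.trans ?_)
  exact ((Equiv.prodComm _ _).subtypeEquiv fun x => Iff.rfl).trans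
    (Equiv.subtypeProdEquivSigmaSubtype fun (x : Bool × Bool × Bool)
      (H : {H : SimpleGraph V // H ≤ G}) => P (E.extend H.1 x.1 x.2.1 x.2.2))

theorem natCard_isTree_le_extend [Finite V] [Finite W] (G : SimpleGraph V) :
    Nat.card {K : {K : SimpleGraph W // K ≤ E.extend G true true true} // K.1.IsTree} =
      3 * Nat.card {H : {H : SimpleGraph V // H ≤ G} // H.1.IsTree} +
        Nat.card {H : {H : SimpleGraph V // H ≤ G} //
          ¬ H.1.Adj E.a E.b ∧ (H.1 ⊔ edge E.a E.b).IsTree} := by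
  rw [natCard_subtype_le_extend]
  simp only [isTree_extend_iff, Fintype.sum_prod_type, Fintype.sum_bool]
  simp
  ring

theorem natCard_not_adj_and_isTree_sup_edge_le_extend [Finite V] [Finite W] (G : SimpleGraph V) :
    Nat.card {K : {K : SimpleGraph W // K ≤ E.extend G true true true} //
        ¬ K.1.Adj E.c E.d ∧ (K.1 ⊔ edge E.c E.d).IsTree} =
      2 * Nat.card {H : {H : SimpleGraph V // H ≤ G} // H.1.IsTree} +
        Nat.card {H : {H : SimpleGraph V // H ≤ G} //
          ¬ H.1.Adj E.a E.b ∧ (H.1 ⊔ edge E.a E.b).IsTree} := by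
  rw [E.natCard_subtype_le_extend G fun K => ¬ K.Adj E.c E.d ∧ (K ⊔ edge E.c E.d).IsTree]
  simp only [not_adj_and_isTree_extend_sup_edge_iff, isTree_extend_iff, Fintype.sum_prod_type,
    Fintype.sum_bool]
  simp
  ring

/-- The `2 × (m + 2)` grid as an extension of the `2 × (m + 1)` grid by one rung. -/
def grid (m : ℕ) : RungExtension (Fin 2 × Fin (m + 1)) (Fin 2 × Fin (m + 2)) where
  toFun v := (v.1, v.2.castSucc)
  inj' u v h := by simpa [Prod.ext_iff] using h
  a := (0, Fin.last m)
  b := (1, Fin.last m)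
  c := (0, Fin.last (m + 1))
  d := (1, Fin.last (m + 1))
  hab := by simp
  hcd := by simp
  hc v h := Fin.castSucc_ne_last _ (Prod.ext_iff.1 h).2
  hd v h := Fin.castSucc_ne_last _ (Prod.ext_iff.1 h).2
  exhaust := by
    rintro ⟨i, j⟩
    induction j using Fin.lastCases with
    | last => fin_cases i <;> simp
    | cast j => exact Or.inl ⟨(i, j), rfl⟩

theorem grid_extend (m : ℕ) :
    (grid m).extend (pathGraph 2 □ pathGraph (m + 1)) true true true =
      pathGraph 2 □ pathGraph (m + 2) := by
  have he : ∀ v, (grid m).toEmbedding v = (v.1, v.2.castSucc) := fun _ => rfl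
  have ha : (grid m).a = (0, Fin.last m) := rfl
  have hb : (grid m).b = (1, Fin.last m) := rfl
  have hc : (grid m).c = (0, Fin.last (m + 1)) := rfl
  have hd : (grid m).d = (1, Fin.last (m + 1)) := rfl
  ext w w'
  rcases (grid m).eq_emb_or w with ⟨v, rfl⟩ | rfl | rfl <;>
    rcases (grid m).eq_emb_or w' with ⟨v', rfl⟩ | rfl | rfl <;>
    simp only [extend_adj_emb, extend_adj_emb_c, extend_adj_emb_d, extend_adj_c_d,
      extend_adj_c_emb, extend_adj_d_emb, extend_adj_d_c, SimpleGraph.irrefl] <;>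
    simp only [he, ha, hb, hc, hd, boxProd_adj, pathGraph_adj, Prod.ext_iff, Fin.ext_iff,
      Fin.val_castSucc, Fin.val_last, Fin.val_zero, Fin.val_one] <;>
    grind

end RungExtension

theorem gridTreeCount_two_eq (n : ℕ) : gridTreeCount 2 n = Nat.card
    {H : {H : SimpleGraph (Fin 2 × Fin n) // H ≤ pathGraph 2 □ pathGraph n} // H.1.IsTree} :=
  spanningTreeCount_eq _

theorem gridForestCount_succ_eq (m : ℕ) : gridForestCount (m + 1) = Nat.card
    {H : {H : SimpleGraph (Fin 2 × Fin (m + 1)) // H ≤ pathGraph 2 □ pathGraph (m + 1)} //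
      ¬ H.1.Adj (0, Fin.last m) (1, Fin.last m) ∧
        (H.1 ⊔ edge (0, Fin.last m) (1, Fin.last m)).IsTree} := by
  rw [gridForestCount, natCard_spanning_subgraph _ fun H => H.IsAcyclic ∧
    Nat.card H.ConnectedComponent = 2 ∧ ¬ H.Reachable (0, Fin.last m) (1, Fin.last m)]
  exact Nat.card_congr (Equiv.subtypeEquivRight fun H =>
    isAcyclic_and_card_eq_two_and_not_reachable_iff (by simp))

theorem gridTreeCount_forestCount_two_recurrences :
    ∀ n : ℕ, 2 ≤ n →
      gridTreeCount 2 n = 3 * gridTreeCount 2 (n - 1) + gridForestCount (n - 1) ∧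
      gridForestCount n = 2 * gridTreeCount 2 (n - 1) + gridForestCount (n - 1) := by
  intro n hn
  obtain ⟨m, rfl⟩ := Nat.exists_eq_add_of_le' hn
  rw [show m + 2 - 1 = m + 1 from rfl, gridForestCount_succ_eq, gridForestCount_succ_eq,
    gridTreeCount_two_eq, gridTreeCount_two_eq, ← RungExtension.grid_extend]
  exact ⟨(RungExtension.grid m).natCard_isTree_le_extend _,
    (RungExtension.grid m).natCard_not_adj_and_isTree_sup_edge_le_extend _⟩
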